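/- Let α be irrational with a_n ≥ 2 for infinitely many n, and let β₀ = Σ_{n=0}^{∞} ρ_n, where ρ_n = q_n α − p_n (this series converges absolutely since |ρ_n| < 1/q_{n+1}). Then β₀ is not on the R_α-orbit of 0 in T = ℝ/ℤ: for every integer m ∈ ℤ, β₀ − mα ∉ ℤ. -/

import Mathlib

/-- The complete quotients of the continued fraction expansion of `α`
(`cfQuot α 0 = α`, and `cfQuot α (n+1)` is the inverse of the fractional part
of `cfQuot α n`). -/
noncomputable def cfQuot (α : ℝ) : ℕ → ℝ
  | 0 => α
  | n + 1 => (cfQuot α n - ⌊cfQuot α n⌋)⁻¹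

/-- The partial quotients `aₙ` of the continued fraction expansion
`α = [a₀; a₁, a₂, …]` (as natural numbers; for irrational `α` and `n ≥ 1`
one has `cfa α n ≥ 1`). -/
noncomputable def cfa (α : ℝ) (n : ℕ) : ℕ := (⌊cfQuot α n⌋).toNat

/-- The denominators `qₙ` of the convergents `pₙ/qₙ` of `α`:
`q₀ = 1`, `q₁ = a₁` and `q_{n+2} = a_{n+2} q_{n+1} + q_n`. -/
noncomputable def cfq (α : ℝ) : ℕ → ℕ
  | 0 => 1
  | 1 => cfa α 1
  | n + 2 => cfa α (n + 2) * cfq α (n + 1) + cfq α n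

/-- The numerators `pₙ` of the convergents `pₙ/qₙ` of `α`:
`p₀ = a₀`, `p₁ = a₁ a₀ + 1` and `p_{n+2} = a_{n+2} p_{n+1} + pₙ`. -/
noncomputable def cfp (α : ℝ) : ℕ → ℤ
  | 0 => ⌊α⌋
  | 1 => (cfa α 1 : ℤ) * ⌊α⌋ + 1
  | n + 2 => (cfa α (n + 2) : ℤ) * cfp α (n + 1) + cfp α n

/-- `ρₙ = qₙ α − pₙ`. -/
noncomputable def cfrho (α : ℝ) (n : ℕ) : ℝ := (cfq α n : ℝ) * α - (cfp α n : ℝ)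

/-- `λ⁽ⁿ⁾ = |ρₙ| = ‖qₙ α‖`, the distance from `qₙ α` to the nearest integer. -/
noncomputable def cflam (α : ℝ) (n : ℕ) : ℝ := |cfrho α n|

theorem cfQuot_irrational {α : ℝ} (hα : Irrational α) (n : ℕ) : Irrational (cfQuot α n) := by
  induction n with
  | zero => exact hα
  | succ n ih => exact (ih.sub_intCast _).inv

theorem cfQuot_fract_pos {α : ℝ} (hα : Irrational α) (n : ℕ) :
    0 < cfQuot α n - ⌊cfQuot α n⌋ :=
  sub_pos.2 (lt_of_le_of_ne (Int.floor_le _) ((cfQuot_irrational hα n).ne_int _).symm)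

theorem one_lt_cfQuot_succ {α : ℝ} (hα : Irrational α) (n : ℕ) : 1 < cfQuot α (n + 1) := by
  refine (one_lt_inv₀ (cfQuot_fract_pos hα n)).2 ?_
  linarith [Int.lt_floor_add_one (cfQuot α n)]

theorem one_le_floor_cfQuot_succ {α : ℝ} (hα : Irrational α) (n : ℕ) :
    1 ≤ ⌊cfQuot α (n + 1)⌋ :=
  Int.le_floor.2 (by exact_mod_cast (one_lt_cfQuot_succ hα n).le)

theorem one_le_cfa_succ {α : ℝ} (hα : Irrational α) (n : ℕ) : 1 ≤ cfa α (n + 1) := by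
  have := one_le_floor_cfQuot_succ hα n
  unfold cfa
  omega

theorem cfa_succ_cast {α : ℝ} (hα : Irrational α) (n : ℕ) :
    (cfa α (n + 1) : ℝ) = ⌊cfQuot α (n + 1)⌋ := by
  have h : (cfa α (n + 1) : ℤ) = ⌊cfQuot α (n + 1)⌋ :=
    Int.toNat_of_nonneg (by linarith [one_le_floor_cfQuot_succ hα n])
  exact_mod_cast h

theorem cfrho_add_two (α : ℝ) (n : ℕ) :
    cfrho α (n + 2) = cfa α (n + 2) * cfrho α (n + 1) + cfrho α n := by
  simp only [cfrho, cfq, cfp]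
  push_cast
  ring

theorem cfrho_succ_mul_cfQuot {α : ℝ} (hα : Irrational α) (n : ℕ) :
    cfrho α (n + 1) * cfQuot α (n + 2) = -cfrho α n := by
  have key (j : ℕ) : (cfQuot α j - ⌊cfQuot α j⌋) * cfQuot α (j + 1) = 1 :=
    mul_inv_cancel₀ (cfQuot_fract_pos hα j).ne'
  induction n with
  | zero =>
    have h0 : (α - ⌊α⌋) * cfQuot α 1 = 1 := key 0
    have h1 := key 1
    have ha := cfa_succ_cast hα 0
    simp only [cfrho, cfq, cfp, zero_add] at *
    push_cast
    rw [ha]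
    linear_combination (-(α - ⌊α⌋)) * h1 + cfQuot α 2 * h0
  | succ n ih =>
    have h := key (n + 2)
    rw [cfrho_add_two, cfa_succ_cast hα (n + 1)]
    linear_combination (-cfrho α (n + 1)) * h + cfQuot α (n + 3) * ih

theorem neg_one_pow_mul_cfrho_pos {α : ℝ} (hα : Irrational α) (n : ℕ) :
    0 < (-1) ^ n * cfrho α n := by
  induction n with
  | zero => simpa [cfrho, cfq, cfp, cfQuot] using cfQuot_fract_pos hα 0
  | succ n ih =>
    have h := cfrho_succ_mul_cfQuot hα n
    have hq := one_lt_cfQuot_succ hα (n + 1)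
    refine pos_of_mul_pos_left (b := cfQuot α (n + 2)) ?_ (by linarith)
    rw [mul_assoc, h, pow_succ]
    linarith

theorem cflam_eq {α : ℝ} (hα : Irrational α) (n : ℕ) : cflam α n = (-1) ^ n * cfrho α n := by
  rw [← abs_of_pos (neg_one_pow_mul_cfrho_pos hα n), abs_mul, abs_neg_one_pow, one_mul, cflam]

theorem cfrho_eq {α : ℝ} (hα : Irrational α) (n : ℕ) : cfrho α n = (-1) ^ n * cflam α n := by
  rw [cflam_eq hα, ← mul_assoc, ← mul_pow]
  simp

theorem cflam_pos {α : ℝ} (hα : Irrational α) (n : ℕ) : 0 < cflam α n := by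
  rw [cflam_eq hα]
  exact neg_one_pow_mul_cfrho_pos hα n

theorem cflam_succ_lt {α : ℝ} (hα : Irrational α) (n : ℕ) : cflam α (n + 1) < cflam α n := by
  have h := congrArg abs (cfrho_succ_mul_cfQuot hα n)
  have hq := one_lt_cfQuot_succ hα (n + 1)
  rw [abs_mul, abs_neg, abs_of_pos (by linarith : 0 < cfQuot α (n + 2))] at h
  change cflam α (n + 1) * _ = cflam α n at h
  nlinarith [cflam_pos hα (n + 1)]

theorem cflam_succ_add_cflam_add_two_le {α : ℝ} (hα : Irrational α) (n : ℕ) :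
    cflam α (n + 1) + cflam α (n + 2) ≤ cflam α n := by
  have h : cflam α (n + 2) = cflam α n - cfa α (n + 2) * cflam α (n + 1) := by
    rw [cflam_eq hα, cflam_eq hα, cflam_eq hα, cfrho_add_two]
    ring
  have ha : (1 : ℝ) ≤ cfa α (n + 2) := by exact_mod_cast one_le_cfa_succ hα (n + 1)
  nlinarith [cflam_pos hα (n + 1)]

theorem summable_cflam {α : ℝ} (hα : Irrational α) : Summable (cflam α) := by
  refine (summable_nat_add_iff 1).1 (summable_of_sum_range_le (c := cflam α 0 + cflam α 1)
    (fun n => (cflam_pos hα _).le) fun n => ?_)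
  have h : ∑ i ∈ Finset.range n, cflam α (i + 1) + cflam α n + cflam α (n + 1)
      ≤ cflam α 0 + cflam α 1 := by
    induction n with
    | zero => simp
    | succ n ih =>
      rw [Finset.sum_range_succ]
      linarith [cflam_succ_add_cflam_add_two_le hα n]
  linarith [cflam_pos hα n, cflam_pos hα (n + 1)]

theorem summable_cfrho {α : ℝ} (hα : Irrational α) : Summable (cfrho α) :=
  (summable_cflam hα).of_abs

theorem abs_tsum_cfrho_add_lt {α : ℝ} (hα : Irrational α) (N : ℕ) :
    |∑' n, cfrho α (n + N)| < cflam α N := by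
  have hs : Summable fun n => cfrho α (n + N) := (summable_nat_add_iff N).2 (summable_cfrho hα)
  have ht := (hs.mul_left ((-1) ^ N)).hasSum.tendsto_sum_nat
  rw [tsum_mul_left] at ht
  have hterm (n : ℕ) : (-1) ^ N * cfrho α (n + N) = (-1) ^ n * cflam α (n + N) := by
    rw [cflam_eq hα, pow_add]
    rcases neg_one_pow_eq_or ℝ n with h | h <;> simp [h]
  simp only [hterm] at ht
  have hanti : Antitone fun n => cflam α (n + N) := antitone_nat_of_succ_le fun n => by
    rw [add_right_comm]
    exact (cflam_succ_lt hα _).le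
  have hlow := hanti.alternating_series_le_tendsto ht 1
  have hupp := hanti.tendsto_le_alternating_series ht 1
  simp only [mul_one, Nat.reduceAdd, Finset.sum_range_succ, Finset.range_zero, Finset.sum_empty,
    pow_zero, pow_one, zero_add, one_mul, add_comm _ N] at hlow hupp
  have h1 := cflam_succ_lt hα N
  have h2 := cflam_succ_lt hα (N + 1)
  rw [← one_mul |_|, ← abs_neg_one_pow N, ← abs_mul, abs_lt]
  simp only [add_zero, add_comm _ N] at *
  have h2' : cflam α (N + 2) < cflam α (N + 1) := h2
  constructor
  · linarith [cflam_pos hα N]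
  · linarith

theorem cfq_succ_mul_cfp_sub (α : ℝ) (n : ℕ) :
    (cfq α (n + 1) : ℤ) * cfp α n - cfq α n * cfp α (n + 1) = (-1) ^ (n + 1) := by
  induction n with
  | zero => simp [cfq, cfp]
  | succ n ih =>
    rw [pow_succ, ← ih]
    simp only [cfq, cfp]
    push_cast
    ring

theorem cfq_pos {α : ℝ} (hα : Irrational α) : ∀ n, 0 < cfq α n
  | 0 => one_pos
  | 1 => one_le_cfa_succ hα 0
  | n + 2 => Nat.add_pos_right _ (cfq_pos hα n)

theorem cfq_add_cfq_succ_le {α : ℝ} (hα : Irrational α) (n : ℕ) :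
    cfq α n + cfq α (n + 1) ≤ cfq α (n + 2) := by
  have h := Nat.le_mul_of_pos_left (cfq α (n + 1)) (one_le_cfa_succ hα (n + 1))
  rw [add_comm]
  exact Nat.add_le_add_right h _

theorem le_cfq {α : ℝ} (hα : Irrational α) : ∀ n, n ≤ cfq α n
  | 0 => Nat.zero_le _
  | 1 => cfq_pos hα 1
  | n + 2 => by
    have h1 := le_cfq hα (n + 1)
    have h2 := cfq_pos hα n
    have h3 := cfq_add_cfq_succ_le hα n
    omega

theorem sum_range_cfq_le {α : ℝ} (hα : Irrational α) (n : ℕ) :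
    ∑ i ∈ Finset.range n, cfq α i ≤ cfq α (n + 1) := by
  induction n with
  | zero => simp
  | succ n ih =>
    rw [Finset.sum_range_succ]
    linarith [cfq_add_cfq_succ_le hα n]

/-- Law of best approximation for convergents. -/
theorem cflam_le_abs_mul_sub {α : ℝ} (hα : Irrational α) (n : ℕ) {q : ℤ} (p : ℤ) (hq : 0 < q)
    (hqn : q < cfq α (n + 1)) : cflam α n ≤ |q * α - p| := by
  obtain ⟨x, y, hx, hy⟩ : ∃ x y : ℤ, q = x * cfq α n + y * cfq α (n + 1) ∧
      p = x * cfp α n + y * cfp α (n + 1) := by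
    have hd := cfq_succ_mul_cfp_sub α n
    have he : ((-1) ^ (n + 1) * (-1) ^ (n + 1) : ℤ) = 1 := by rw [← mul_pow]; simp
    refine ⟨(-1) ^ (n + 1) * (cfq α (n + 1) * p - cfp α (n + 1) * q),
      (-1) ^ (n + 1) * (cfp α n * q - cfq α n * p), ?_, ?_⟩
    · linear_combination (-q) * he - (-1) ^ (n + 1) * q * hd
    · linear_combination (-p) * he - (-1) ^ (n + 1) * p * hd
  have hval : |q * α - p| = |x * cflam α n - y * cflam α (n + 1)| := by
    have : (q * α - p : ℝ) = (-1) ^ n * (x * cflam α n - y * cflam α (n + 1)) := by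
      have h0 := cfrho_eq hα n
      have h1 := cfrho_eq hα (n + 1)
      rw [pow_succ] at h1
      rw [hx, hy]
      simp only [cfrho] at h0 h1
      push_cast
      linear_combination (x : ℝ) * h0 + (y : ℝ) * h1
    rw [this, abs_mul, abs_neg_one_pow, one_mul]
  have hl0 := cflam_pos hα n
  have hl1 := cflam_pos hα (n + 1)
  have hq0 : (0 : ℤ) < cfq α n := by exact_mod_cast cfq_pos hα n
  have hq1 : (0 : ℤ) < cfq α (n + 1) := by exact_mod_cast cfq_pos hα (n + 1)
  rw [hval]
  rcases le_or_gt x 0 with hx0 | hx0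
  · have hypos : 0 < y := by
      by_contra! h
      nlinarith
    have hxneg : x ≤ -1 := by
      by_contra! h
      obtain rfl : x = 0 := by omega
      nlinarith
    have hx' : (x : ℝ) ≤ -1 := by exact_mod_cast hxneg
    have hy' : (0 : ℝ) < y := by exact_mod_cast hypos
    refine le_trans ?_ (neg_le_abs _)
    nlinarith [mul_pos hy' hl1]
  · have hynonpos : y ≤ 0 := by
      by_contra! h
      nlinarith
    have hx' : (1 : ℝ) ≤ x := by exact_mod_cast hx0
    have hy' : (y : ℝ) ≤ 0 := by exact_mod_cast hynonpos
    refine le_trans ?_ (le_abs_self _)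
    nlinarith [mul_nonneg (neg_nonneg.2 hy') hl1.le]

/-- Let `α` be irrational with `aₙ ≥ 2` for infinitely many
`n`, and let `β₀ = Σ_{n=0}^∞ ρₙ` where `ρₙ = qₙα − pₙ`.  Then `β₀` is not on
the `R_α`-orbit of `0` in `T = ℝ/ℤ`: for every `m ∈ ℤ`, `β₀ − mα ∉ ℤ`. -/
theorem stmt_19 (α : ℝ) (hα : Irrational α)
    (ha2 : ∀ N : ℕ, ∃ n ≥ N, 2 ≤ cfa α n) :
    ∀ m k : ℤ, (∑' n : ℕ, cfrho α n) - (m : ℝ) * α ≠ (k : ℝ) := by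
  intro m k h
  obtain ⟨n, hn, han⟩ := ha2 (m.natAbs + 3)
  obtain ⟨M, rfl⟩ : ∃ M, n = M + 2 := ⟨n - 2, by omega⟩
  have hsplit := (summable_cfrho hα).sum_add_tsum_nat_add (M + 1)
  have htail := abs_tsum_cfrho_add_lt hα (M + 1)
  have hsum : ∑ i ∈ Finset.range (M + 1), cfrho α i =
      (∑ i ∈ Finset.range (M + 1), cfq α i : ℕ) * α
        - (∑ i ∈ Finset.range (M + 1), cfp α i : ℤ) := by
    simp only [cfrho, Finset.sum_sub_distrib, ← Finset.sum_mul]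
    push_cast
    rfl
  have hQ : ∑ i ∈ Finset.range (M + 1), cfq α i
      = ∑ i ∈ Finset.range M, cfq α i + cfq α M := Finset.sum_range_succ _ _
  generalize ∑ i ∈ Finset.range (M + 1), cfq α i = Q at hsum hQ
  generalize ∑ i ∈ Finset.range (M + 1), cfp α i = P at hsum
  have hle := sum_range_cfq_le hα M
  have hM := le_cfq hα M
  have hM1 := le_cfq hα (M + 1)
  have hq : 2 * cfq α (M + 1) + cfq α M ≤ cfq α (M + 2) :=
    Nat.add_le_add_right (Nat.mul_le_mul_right _ han) _
  have hbest := cflam_le_abs_mul_sub hα (M + 1) (q := Q - m) (P + k) (by omega)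
    (by push_cast [add_assoc]; omega)
  have heq : ((Q - m : ℤ) * α - (P + k : ℤ) : ℝ) = -∑' i, cfrho α (i + (M + 1)) := by
    push_cast
    linear_combination h + hsplit - hsum
  rw [heq, abs_neg] at hbest
  exact absurd htail hbest.not_gt
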